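/- Let T be an affine algebraic theory with Mal'cev operation p, let f ∈ T(n) and g₁,…,gₙ ∈ T(m). Then for every 1 ≤ i ≤ m the i-th coefficient of the composite satisfies (f ∘ (g₁,…,gₙ))[i] = f[1]·g₁[i] + f[2]·g₂[i] + ⋯ + f[n]·gₙ[i] (left-associated sum in T(2), with a + b := p ∘ (a, π²₂, b) and a · b := a ∘ (b, π²₂)). (This is the key identity showing that the coefficient map T(n) → T(2)ⁿ is a morphism of theories.) -/

import Mathlib

/-!
An algebraic theory (abstract clone): a family of sets `T n`,
projections `π n i` and composition `comp`, subject to the unit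
and associativity laws.
-/
universe u

structure Clone where
  T : ℕ → Type u
  π : (n : ℕ) → Fin n → T n
  comp : {n m : ℕ} → T n → (Fin n → T m) → T m
  comp_proj : ∀ {n m : ℕ} (i : Fin n) (g : Fin n → T m), comp (π n i) g = g i
  proj_comp : ∀ {n : ℕ} (f : T n), comp f (π n) = f
  assoc : ∀ {n m k : ℕ} (f : T n) (g : Fin n → T m) (h : Fin m → T k),
      comp (comp f g) h = comp f (fun i => comp (g i) h)

namespace Clone

variable (C : Clone)

/-- `f` is idempotent: `f ∘ (g,…,g) = g`. -/
def Idem {n : ℕ} (f : C.T n) : Prop :=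
  ∀ (m : ℕ) (g : C.T m), C.comp f (fun _ => g) = g

/-- `f` splits: `f(f(x¹₁,…,x¹ₙ),…,f(xⁿ₁,…,xⁿₙ)) = f(x¹₁,x²₂,…,xⁿₙ)` as an identity. -/
def Splits {n : ℕ} (f : C.T n) : Prop :=
  ∀ (m : ℕ) (x : Fin n → Fin n → C.T m),
    C.comp f (fun i => C.comp f (x i)) = C.comp f (fun i => x i i)

/-- `f` and `g` commute. -/
def Commutes {n m : ℕ} (f : C.T n) (g : C.T m) : Prop :=
  ∀ (k : ℕ) (x : Fin n → Fin m → C.T k),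
    C.comp f (fun i => C.comp g (x i)) = C.comp g (fun j => C.comp f (fun i => x i j))

/-- A theory is hyperaffine if every operation is idempotent, every pair of
operations commutes, and every operation splits. -/
def Hyperaffine : Prop :=
  (∀ (n : ℕ) (f : C.T n), C.Idem f) ∧
  (∀ (n m : ℕ) (f : C.T n) (g : C.T m), C.Commutes f g) ∧
  (∀ (n : ℕ) (f : C.T n), C.Splits f)

/-- The `i`-th coefficient `f[i] := f ∘ (π²₂,…,π²₁,…,π²₂)` with `π²₁` in position `i`. -/
def coeff {n : ℕ} (f : C.T n) (i : Fin n) : C.T 2 :=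
  C.comp f (fun j => if j = i then C.π 2 0 else C.π 2 1)

/-- `a ∧ b := a ∘ (b, π²₂)` on `T 2`. -/
def band (a b : C.T 2) : C.T 2 := C.comp a ![b, C.π 2 1]

/-- `a ∨ b := a ∘ (π²₁, b)` on `T 2`. -/
def bor (a b : C.T 2) : C.T 2 := C.comp a ![C.π 2 0, b]

/-- `¬a := a ∘ (π²₂, π²₁)` on `T 2`. -/
def bnot (a : C.T 2) : C.T 2 := C.comp a ![C.π 2 1, C.π 2 0]

/-- `p ∈ T 3` is a Mal'cev operation: `p(x,y,y) = x` and `p(x,x,y) = y`. -/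
def Malcev (p : C.T 3) : Prop :=
  ∀ (m : ℕ) (x y : C.T m), C.comp p ![x, y, y] = x ∧ C.comp p ![x, x, y] = y

/-- `a + b := p ∘ (a, π²₂, b)` on `T 2`. -/
def padd (p : C.T 3) (a b : C.T 2) : C.T 2 := C.comp p ![a, C.π 2 1, b]

/-- `-a := p ∘ (π²₂, a, π²₂)` on `T 2`. -/
def pneg (p : C.T 3) (a : C.T 2) : C.T 2 := C.comp p ![C.π 2 1, a, C.π 2 1]

end Clone

/-- Right-nested fold: `rfold op a [b, c] = op a (op b c)`. -/
def rfold {α : Type*} (op : α → α → α) : α → List α → α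
  | a, [] => a
  | a, b :: l => op a (rfold op b l)

/-- Left-nested fold: `lfold op a [b, c] = op (op a b) c`. -/
def lfold {α : Type*} (op : α → α → α) (a : α) (l : List α) : α := l.foldl op a

namespace Clone

variable (C : Clone)

theorem coeff_comp {n m : ℕ} (f : C.T n) (g : Fin n → C.T m) (i : Fin m) :
    C.coeff (C.comp f g) i = C.comp f (fun k => C.coeff (g k) i) :=
  C.assoc _ _ _

theorem band_coeff {n : ℕ} (f : C.T n) (k : Fin n) (a : C.T 2) :
    C.band (C.coeff f k) a = C.comp f (fun j => if j = k then a else C.π 2 1) := by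
  simp only [band, coeff, C.assoc]
  congr 1
  funext j
  split_ifs <;> simp [C.comp_proj]

/-- An idempotent operation commuting with `p` is additive in its arguments. -/
theorem padd_comp {n : ℕ} {f : C.T n} {p : C.T 3} (hf : C.Idem f) (hfp : C.Commutes f p)
    (x y : Fin n → C.T 2) :
    C.padd p (C.comp f x) (C.comp f y) = C.comp f (fun j => C.padd p (x j) (y j)) := by
  have h := hfp 2 (fun j => ![x j, C.π 2 1, y j])
  simp only [padd]
  rw [h]
  congr 1
  funext j
  fin_cases j
  · rfl
  · exact (hf 2 (C.π 2 1)).symm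
  · rfl

theorem padd_proj {p : C.T 3} (hp : C.Malcev p) (a : C.T 2) : C.padd p a (C.π 2 1) = a :=
  (hp 2 a (C.π 2 1)).1

theorem proj_padd {p : C.T 3} (hp : C.Malcev p) (a : C.T 2) : C.padd p (C.π 2 1) a = a :=
  (hp 2 (C.π 2 1) a).2

/-- Adding the terms `f[k] · a k`, for `k` in `l`, to `f` evaluated at `a` cut off outside `s`
extends the cut-off to `s ∪ l`. -/
theorem foldl_padd_band_coeff {n : ℕ} {f : C.T n} {p : C.T 3} (hf : C.Idem f)
    (hfp : C.Commutes f p) (hp : C.Malcev p) (a : Fin n → C.T 2) (l : List (Fin n))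
    (hl : l.Nodup) (s : Finset (Fin n)) (hs : ∀ k ∈ l, k ∉ s) :
    (l.map fun k => C.band (C.coeff f k) (a k)).foldl (C.padd p)
        (C.comp f (fun j => if j ∈ s then a j else C.π 2 1)) =
      C.comp f (fun j => if j ∈ s ∨ j ∈ l then a j else C.π 2 1) := by
  induction l generalizing s with
  | nil => simp
  | cons k l ih =>
    rw [List.nodup_cons] at hl
    have hks : k ∉ s := hs k (by simp)
    have key : (fun j => C.padd p (if j ∈ s then a j else C.π 2 1)
        (if j = k then a k else C.π 2 1)) =
        fun j => if j ∈ insert k s then a j else C.π 2 1 := by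
      funext j
      by_cases hj : j = k
      · subst hj
        simp [hks, C.proj_padd hp]
      · simp [hj, C.padd_proj hp]
    rw [List.map_cons, List.foldl_cons, C.band_coeff, C.padd_comp hf hfp, key,
      ih hl.2 (insert k s)]
    · simp only [Finset.mem_insert, List.mem_cons, or_left_comm, or_assoc]
    · intro j hj hjs
      rcases Finset.mem_insert.mp hjs with rfl | hjs
      · exact hl.1 hj
      · exact hs j (by simp [hj]) hjs

end Clone

/-- In an affine theory with Mal'cev operation `p`, the `i`-th coefficient of a
composite satisfies `(f ∘ (g₁,…,gₙ))[i] = f[1]·g₁[i] + f[2]·g₂[i] + ⋯ + f[n]·gₙ[i]`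
(left-associated sum, `a + b := p ∘ (a, π²₂, b)`, `a · b := a ∘ (b, π²₂)`). -/
theorem coeff_comp_of_affine (C : Clone)
    (hidem : ∀ (n : ℕ) (f : C.T n), C.Idem f)
    (hcomm : ∀ (n m : ℕ) (f : C.T n) (g : C.T m), C.Commutes f g)
    (p : C.T 3) (hp : C.Malcev p)
    (n m : ℕ) (f : C.T (n + 1)) (g : Fin (n + 1) → C.T m) (i : Fin m) :
    C.coeff (C.comp f g) i =
      lfold (C.padd p) (C.band (C.coeff f 0) (C.coeff (g 0) i))
        (List.ofFn fun k : Fin n => C.band (C.coeff f k.succ) (C.coeff (g k.succ) i)) := by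
  have h := C.foldl_padd_band_coeff (hidem _ f) (hcomm _ _ f p) hp (fun k => C.coeff (g k) i)
    ((List.finRange n).map Fin.succ)
    ((List.nodup_finRange n).map (Fin.succ_injective n)) {0} (by simp)
  have hall (j : Fin (n + 1)) : j = 0 ∨ ∃ k : Fin n, k.succ = j := by
    simpa only [eq_comm] using Fin.eq_zero_or_eq_succ j
  have hzero : C.comp f (fun j => if j = 0 then C.coeff (g j) i else C.π 2 1) =
      C.band (C.coeff f 0) (C.coeff (g 0) i) := by
    rw [C.band_coeff]
    congr 1
    funext j
    split_ifs with hj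
    · rw [hj]
    · rfl
  simp only [Finset.mem_singleton, List.mem_map, List.mem_finRange, true_and, hall, if_true,
    hzero, List.map_map] at h
  rw [C.coeff_comp, lfold, List.ofFn_eq_map]
  exact h.symm
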